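/- Let X and Y be distinct nodes in an MPDAG G = (V,E) with Y ∉ Pa(X,G). If there is no possibly causal path from X to Y in G that starts with an undirected edge, then the set Pa(X,G) of parents of X in G satisfies the generalized adjustment criterion relative to (X,Y) in G; that is: (1) there is no proper possibly causal path from X to Y in G that starts with an undirected edge, (2) Pa(X,G) ∩ forb(X,Y,G) = ∅, and (3) every proper non-causal definite status path from X to Y in G is blocked by Pa(X,G). -/

import Mathlib

open scoped Classical

noncomputable section

/-- A partially directed graph on node type `V`: directed (`dir`) and undirected (`undir`)
edges, with at most one edge between any two nodes. -/
structure PDG (V : Type) where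
  dir : V → V → Prop
  undir : V → V → Prop
  undir_symm : ∀ a b, undir a b → undir b a
  dir_irrefl : ∀ a, ¬ dir a a
  undir_irrefl : ∀ a, ¬ undir a a
  dir_asymm : ∀ a b, dir a b → ¬ dir b a
  dir_not_undir : ∀ a b, dir a b → ¬ undir a b

namespace PDG

variable {V : Type}

/-- Two nodes are adjacent if there is an edge between them. -/
def Adj (G : PDG V) (a b : V) : Prop := G.dir a b ∨ G.dir b a ∨ G.undir a b

/-- No directed cycles. -/
def Acyclic (G : PDG V) : Prop := ∀ a, ¬ Relation.TransGen G.dir a a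

/-- A maximally oriented PDAG (MPDAG): a partially directed graph with no directed
cycles, in which none of the four configurations of Meek's orientation rules occurs
as an induced subgraph. -/
structure IsMPDAG (G : PDG V) : Prop where
  acyclic : G.Acyclic
  meek1 : ∀ a b c, G.dir a b → G.undir b c → G.Adj a c
  meek2 : ∀ a b c, G.dir a b → G.dir b c → ¬ G.undir a c
  meek3 : ∀ i j k l, k ≠ l → G.undir i j → G.undir i k → G.undir i l →
      G.dir k j → G.dir l j → G.Adj k l
  meek4 : ∀ i j k l, G.undir i j → G.undir i k → G.undir i l →
      G.dir j l → G.dir l k → G.Adj j k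

/-- A DAG: only directed edges, no directed cycles. -/
def IsDAG (G : PDG V) : Prop := (∀ a b, ¬ G.undir a b) ∧ G.Acyclic

/-- `⟨a,b,c⟩` is an unshielded collider. -/
def UnshieldedCollider (G : PDG V) (a b c : V) : Prop :=
  a ≠ c ∧ G.dir a b ∧ G.dir c b ∧ ¬ G.Adj a c

/-- `D ∈ [G]` : `D` is a DAG represented by the MPDAG `G`: same adjacencies,
same unshielded colliders, containing every directed edge of `G`. -/
def InClassOf (D G : PDG V) : Prop :=
  IsDAG D ∧ (∀ a b, G.Adj a b ↔ D.Adj a b) ∧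
    (∀ a b c, G.UnshieldedCollider a b c ↔ D.UnshieldedCollider a b c) ∧
    (∀ a b, G.dir a b → D.dir a b)

/-- `p` is a path: a sequence of at least two distinct nodes in which every pair of
successive nodes is adjacent. -/
def IsPath (G : PDG V) (p : List V) : Prop :=
  2 ≤ p.length ∧ p.Nodup ∧ p.Chain' G.Adj

/-- `p` is a path from `a` to `b`. -/
def IsPathFrom (G : PDG V) (p : List V) (a b : V) : Prop :=
  G.IsPath p ∧ p.head? = some a ∧ p.getLast? = some b

/-- `p` is a possibly causal path: no edge `V_i ← V_j` with `i < j` is in `G`. -/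
def PossiblyCausal (G : PDG V) (p : List V) : Prop :=
  G.IsPath p ∧ ∀ i j : Fin p.length, (i : ℕ) < (j : ℕ) → ¬ G.dir (p.get j) (p.get i)

/-- `p` is a causal path: all edges directed towards the endpoint. -/
def IsCausal (G : PDG V) (p : List V) : Prop :=
  2 ≤ p.length ∧ p.Nodup ∧ p.Chain' G.dir

/-- `p` is an undirected path. -/
def IsUndirPath (G : PDG V) (p : List V) : Prop :=
  p ≠ [] ∧ p.Nodup ∧ p.Chain' G.undir

/-- `p` is unshielded: every two nodes at distance two on `p` are nonadjacent. -/
def Unshielded (G : PDG V) (p : List V) : Prop :=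
  ∀ (i : ℕ) (h : i + 2 < p.length),
    ¬ G.Adj (p.get ⟨i, by omega⟩) (p.get ⟨i + 2, h⟩)

/-- `p` is proper w.r.t. the node set `X` : only its first node is in `X`. -/
def ProperFrom (X : Finset V) (p : List V) : Prop :=
  (∃ a ∈ X, p.head? = some a) ∧ ∀ i : Fin p.length, 0 < (i : ℕ) → p.get i ∉ X

/-- the last node of `p` is in `Y`. -/
def EndsIn (Y : Finset V) (p : List V) : Prop := ∃ b ∈ Y, p.getLast? = some b

/-- `p` starts with an undirected edge. -/
def StartsUndirected (G : PDG V) (p : List V) : Prop :=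
  ∃ a b l, p = a :: b :: l ∧ G.undir a b

/-- There is no proper possibly causal path from `X` to `Y` in `G` that starts with
an undirected edge. -/
def NoProperPCUndirStart (G : PDG V) (X Y : Finset V) : Prop :=
  ¬ ∃ p, G.PossiblyCausal p ∧ ProperFrom X p ∧ EndsIn Y p ∧ G.StartsUndirected p

/-- `A` is an undirected connected node set in `G`: every two distinct nodes of `A`
are joined by an undirected path in `G`. -/
def UndirConnected (G : PDG V) (A : Finset V) : Prop :=
  ∀ a ∈ A, ∀ b ∈ A, a ≠ b →
    ∃ p, G.IsUndirPath p ∧ p.head? = some a ∧ p.getLast? = some b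

/-- `B` is a bucket in `D`: a maximal undirected connected subset of `D` in `G`. -/
def Bucket (G : PDG V) (B D : Finset V) : Prop :=
  B.Nonempty ∧ B ⊆ D ∧ G.UndirConnected B ∧
    ∀ B' : Finset V, B ⊆ B' → B' ⊆ D → G.UndirConnected B' → B' = B

section DecEq

variable [DecidableEq V]

/-- `Bs` lists the bucket decomposition of `D`: the listed sets are buckets in `D`,
pairwise disjoint, with union `D`. -/
def IsBucketDecompList (G : PDG V) (D : Finset V) (Bs : List (Finset V)) : Prop :=
  (∀ B ∈ Bs, G.Bucket B D) ∧ (Bs.Pairwise fun B B' => Disjoint B B') ∧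
    Bs.foldr (· ∪ ·) ∅ = D

end DecEq

/-- The listed node sets are totally ordered as a partial causal ordering in `G` :
every edge between an earlier set and a later one points towards the later one. -/
def OrderedDecomp (G : PDG V) (Bs : List (Finset V)) : Prop :=
  ∀ i j : Fin Bs.length, (i : ℕ) < (j : ℕ) →
    ∀ a ∈ Bs.get i, ∀ b ∈ Bs.get j, G.Adj a b → G.dir a b

/-- the node at (interior) position `i` of `p` is a collider on `p`. -/
def ColliderAt (G : PDG V) (p : List V) (i : ℕ) : Prop :=
  ∃ u v w, p[i-1]? = some u ∧ p[i]? = some v ∧ p[i+1]? = some w ∧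
    1 ≤ i ∧ G.dir u v ∧ G.dir w v

/-- the node at (interior) position `i` of `p` is a definite non-collider on `p`. -/
def DefNonColliderAt (G : PDG V) (p : List V) (i : ℕ) : Prop :=
  ∃ u v w, p[i-1]? = some u ∧ p[i]? = some v ∧ p[i+1]? = some w ∧ 1 ≤ i ∧
    (G.dir v u ∨ G.dir v w ∨ (G.undir u v ∧ G.undir v w ∧ ¬ G.Adj u w))

/-- `p` is a definite status path: every interior node is a collider or a definite
non-collider on `p`. -/
def DefiniteStatus (G : PDG V) (p : List V) : Prop :=
  ∀ i : ℕ, 1 ≤ i → i + 1 < p.length → G.ColliderAt p i ∨ G.DefNonColliderAt p i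

/-- `p` is d-connecting given `Z` (in a DAG): every non-collider on `p` is outside
`Z` and every collider on `p` has a descendant in `Z`. -/
def DConnGiven (G : PDG V) (Z : Finset V) (p : List V) : Prop :=
  (∀ i u, 1 ≤ i → i + 1 < p.length → p[i]? = some u → ¬ G.ColliderAt p i → u ∉ Z) ∧
  (∀ i u, G.ColliderAt p i → p[i]? = some u →
    ∃ z ∈ Z, Relation.ReflTransGen G.dir u z)

/-- `A` and `B` are d-separated given `Z` : no path between them is d-connecting
given `Z`. -/
def DSep (G : PDG V) (A B Z : Finset V) : Prop :=
  ∀ p a b, a ∈ A → b ∈ B → G.IsPathFrom p a b → ¬ G.DConnGiven Z p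

/-- `p` is d-connecting given `Z` (definite status version): every definite
non-collider on `p` is outside `Z` and every collider on `p` has a descendant in `Z`. -/
def DConnDS (G : PDG V) (Z : Finset V) (p : List V) : Prop :=
  (∀ i u, G.DefNonColliderAt p i → p[i]? = some u → u ∉ Z) ∧
  (∀ i u, G.ColliderAt p i → p[i]? = some u →
    ∃ z ∈ Z, Relation.ReflTransGen G.dir u z)

/-- `Z` blocks the (definite status) path `p`. -/
def Blocks (G : PDG V) (Z : Finset V) (p : List V) : Prop := ¬ G.DConnDS Z p

/-- `D_{X̄}` : remove all edges into `X`. -/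
def removeInto (D : PDG V) (X : Finset V) : PDG V where
  dir a b := D.dir a b ∧ b ∉ X
  undir := D.undir
  undir_symm := D.undir_symm
  dir_irrefl := fun a h => D.dir_irrefl a h.1
  undir_irrefl := D.undir_irrefl
  dir_asymm := fun a b h h' => D.dir_asymm a b h.1 h'.1
  dir_not_undir := fun a b h => D.dir_not_undir a b h.1

/-- `D_{X̲}` : remove all edges out of `X`. -/
def removeOutOf (D : PDG V) (X : Finset V) : PDG V where
  dir a b := D.dir a b ∧ a ∉ X
  undir := D.undir
  undir_symm := D.undir_symm
  dir_irrefl := fun a h => D.dir_irrefl a h.1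
  undir_irrefl := D.undir_irrefl
  dir_asymm := fun a b h h' => D.dir_asymm a b h.1 h'.1
  dir_not_undir := fun a b h => D.dir_not_undir a b h.1

/-- `w'` is a possible descendant of `w` in `G`. -/
def PossibleDesc (G : PDG V) (w w' : V) : Prop :=
  w = w' ∨ ∃ p, G.PossiblyCausal p ∧ p.head? = some w ∧ p.getLast? = some w'

section Fin

variable [Fintype V] [DecidableEq V]

/-- the parents of the node `v` in `G`. -/
def paFin (G : PDG V) (v : V) : Finset V := Finset.univ.filter fun u => G.dir u v

/-- `Pa(S, G)` : the parents of the node set `S` in `G`, excluding `S` itself. -/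
def PaFin (G : PDG V) (S : Finset V) : Finset V :=
  (Finset.univ.filter fun u => ∃ v ∈ S, G.dir u v) \ S

/-- `a` is an ancestor of `y` within the induced subgraph of `G` on `S`
(every node is an ancestor of itself). -/
def AncestorIn (G : PDG V) (S : Finset V) (a y : V) : Prop :=
  a ∈ S ∧ y ∈ S ∧ Relation.ReflTransGen (fun u v => G.dir u v ∧ u ∈ S ∧ v ∈ S) a y

/-- `An(Y, G_S)` : the ancestors of `Y` in the induced subgraph of `G` on `S`. -/
def AnIn (G : PDG V) (Y S : Finset V) : Finset V :=
  Finset.univ.filter fun a => ∃ y ∈ Y, G.AncestorIn S a y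

/-- `forb(X, Y, G)` for single nodes `X`, `Y` : all possible descendants of nodes
`W ≠ X` lying on a proper possibly causal path from `X` to `Y` in `G`. -/
def Forb (G : PDG V) (X Y : V) : Finset V :=
  Finset.univ.filter fun w' => ∃ w, w ≠ X ∧
    (∃ p, G.PossiblyCausal p ∧ p.head? = some X ∧ p.getLast? = some Y ∧ w ∈ p) ∧
    G.PossibleDesc w w'

end Fin

end PDG

section Density

open PDG

variable {V : Type} [Fintype V] [DecidableEq V] {Ω : Type} [Fintype Ω] [DecidableEq Ω]

/-- the marginal of `f` over the node set `S`, at the values given by `g`. -/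
def margin (f : (V → Ω) → ℝ) (S : Finset V) (g : V → Ω) : ℝ :=
  ∑ h : V → Ω, if ∀ v ∈ S, h v = g v then f h else 0

/-- the conditional density `f(a | b)` of `A` given `B`, at the values given by `g`. -/
def condOn (f : (V → Ω) → ℝ) (A B : Finset V) (g : V → Ω) : ℝ :=
  margin f (A ∪ B) g / margin f B g

/-- `f` is a strictly positive discrete density over `V`. -/
def IsPosDensity (f : (V → Ω) → ℝ) : Prop :=
  (∀ g, 0 < f g) ∧ ∑ g : V → Ω, f g = 1

/-- `f` is consistent with the DAG `D` : it factorizes according to `D`. -/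
def ConsistentWith (f : (V → Ω) → ℝ) (D : PDG V) : Prop :=
  ∀ g, f g = ∏ v : V, condOn f {v} (D.paFin v) g

/-- the interventional density obtained from `f` by truncated factorization with
respect to the DAG `D` under `do(X = x)`, evaluated at `g` (parent values in `X`
are taken in agreement with `x`). -/
def doDens (f : (V → Ω) → ℝ) (D : PDG V) (X : Finset V) (x : V → Ω) (g : V → Ω) : ℝ :=
  ∏ v ∈ Finset.univ \ X, condOn f {v} (D.paFin v) fun u => if u ∈ X then x u else g u

/-- `f(y | do(x))` : the marginal over `Y` of the interventional density obtained
from `f` by truncated factorization with respect to `D`. -/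
def doMargin (f : (V → Ω) → ℝ) (D : PDG V) (X : Finset V) (x : V → Ω)
    (Y : Finset V) (y : V → Ω) : ℝ :=
  ∑ g : V → Ω,
    if (∀ v ∈ X, g v = x v) ∧ (∀ v ∈ Y, g v = y v) then doDens f D X x g else 0

end Density

open PDG

namespace PDG

open Relation

variable {V : Type} {G : PDG V}

theorem Adj.symm {a b : V} (h : G.Adj a b) : G.Adj b a := by
  rcases h with h | h | h
  · exact Or.inr (Or.inl h)
  · exact Or.inl h
  · exact Or.inr (Or.inr (G.undir_symm _ _ h))

theorem IsMPDAG.dir_or_undir_of_dir_undir (hG : G.IsMPDAG) {a b c : V} (hab : G.dir a b)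
    (hbc : G.undir b c) : G.dir a c ∨ G.undir a c := by
  rcases hG.meek1 a b c hab hbc with h | h | h
  · exact Or.inl h
  · exact absurd (G.undir_symm _ _ hbc) (hG.meek2 c a b h hab)
  · exact Or.inr h

/-- A node reached from a descendant of `x` by an undirected edge is a descendant of `x`
or joined to `x` by an undirected edge. -/
theorem IsMPDAG.undir_or_transGen (hG : G.IsMPDAG) {x a c : V} (hxa : ReflTransGen G.dir x a)
    (hac : G.undir a c) : G.undir x c ∨ TransGen G.dir x c := by
  induction hxa with
  | refl => exact Or.inl hac
  | tail hxb hba ih =>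
    rcases hG.dir_or_undir_of_dir_undir hba hac with h | h
    · exact Or.inr (TransGen.tail' hxb h)
    · exact ih h

theorem possiblyCausal_iff {p : List V} : G.PossiblyCausal p ↔
    2 ≤ p.length ∧ p.Nodup ∧ p.IsChain G.Adj ∧ p.Pairwise fun a b => ¬ G.dir b a := by
  unfold PossiblyCausal IsPath
  rw [List.pairwise_iff_get, and_assoc, and_assoc]
  rfl

/-- An induced undirected path, up to repeated nodes. -/
def InducedUndir (G : PDG V) : List V → Prop
  | [] => True
  | [_] => True
  | a :: b :: l => G.undir a b ∧ (∀ c ∈ l, ¬ G.Adj a c) ∧ G.InducedUndir (b :: l)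

/-- An induced undirected path can be shortened to start at a neighbour `a` of one of its
nodes, if none of its nodes points to `a`. -/
theorem IsMPDAG.inducedUndir_cons (hG : G.IsMPDAG) {a : V} {l : List V}
    (hl : G.InducedUndir l) (hadj : ∃ q ∈ l, G.Adj a q) (hback : ∀ q ∈ l, ¬ G.dir q a) :
    (∃ q ∈ l.getLast?, G.dir a q) ∨
      ∃ m, m ≠ [] ∧ m <:+ l ∧ G.InducedUndir (a :: m) := by
  induction l with
  | nil => simp at hadj
  | cons q r ih =>
    by_cases hr : ∃ c ∈ r, G.Adj a c
    · have hr0 : r ≠ [] := by rintro rfl; simp at hr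
      obtain ⟨b, r, rfl⟩ := List.exists_cons_of_ne_nil hr0
      rcases ih hl.2.2 hr (fun c hc => hback c (List.mem_cons_of_mem _ hc)) with h | ⟨m, h0, h1, h2⟩
      · left; simpa using h
      · exact Or.inr ⟨m, h0, h1.trans (List.suffix_cons _ _), h2⟩
    · push Not at hr
      have haq : G.Adj a q := by
        obtain ⟨c, hc, h⟩ := hadj
        rcases List.mem_cons.1 hc with rfl | hc
        · exact h
        · exact absurd h (hr c hc)
      rcases haq with h | h | h
      · left
        cases r with
        | nil => exact ⟨q, by simp, h⟩
        | cons b r => exact absurd (hG.meek1 a q b h hl.1) (hr b (by simp))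
      · exact absurd h (hback q (by simp))
      · exact Or.inr ⟨q :: r, by simp, List.suffix_rfl, h, hr, hl⟩

theorem getLast?_eq_of_suffix {m l : List V} (h : m <:+ l) (hm : m ≠ []) :
    m.getLast? = l.getLast? := by
  obtain ⟨t, rfl⟩ := h
  rw [List.getLast?_append_of_ne_nil _ hm]

/-- The start of an induced undirected path can be moved to a parent `a` of it that is
a descendant of its end. -/
theorem IsMPDAG.inducedUndir_move_start (hG : G.IsMPDAG) {a e : V} {l : List V}
    (hl0 : l ≠ []) (he : l.getLast? = some e) (hea : TransGen G.dir e a) :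
    ∀ {q : V}, G.InducedUndir (q :: l) → G.dir a q →
      ∃ m, m ≠ [] ∧ m.getLast? = some e ∧ G.InducedUndir (a :: m) := by
  induction l with
  | nil => exact absurd rfl hl0
  | cons b r ih =>
    intro q hq haq
    rcases hG.dir_or_undir_of_dir_undir haq hq.1 with h | h
    · cases r with
      | nil =>
        simp only [List.getLast?_singleton, Option.some.injEq] at he
        subst he
        exact absurd (hea.tail h) (hG.acyclic _)
      | cons c r => exact ih (by simp) (by simpa using he) hq.2.2 h
    · have hback : ∀ c ∈ b :: r, ¬ G.dir c a := by
        intro c hc hca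
        rcases List.mem_cons.1 hc with rfl | hc
        · exact G.dir_not_undir _ _ hca (G.undir_symm _ _ h)
        · have hcb := hG.meek1 c a b hca h
          cases r with
          | nil => simp at hc
          | cons d r =>
            rcases List.mem_cons.1 hc with rfl | hc'
            · exact hq.2.1 _ hc (hG.meek4 b c q a hq.2.2.1 (G.undir_symm _ _ hq.1)
                (G.undir_symm _ _ h) hca haq).symm
            · exact hq.2.2.2.1 c hc' hcb.symm
      rcases hG.inducedUndir_cons hq.2.2 ⟨b, by simp, Or.inr (Or.inr h)⟩ hback with
        ⟨x, hx, hax⟩ | ⟨m, h0, h1, h2⟩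
      · rw [he, Option.mem_some_iff] at hx
        subst hx
        exact absurd (hea.tail hax) (hG.acyclic _)
      · exact ⟨m, h0, (getLast?_eq_of_suffix h1 h0).trans he, h2⟩

/-- The start of a nontrivial induced undirected path is not a descendant of its end. -/
theorem IsMPDAG.not_transGen_of_inducedUndir (hG : G.IsMPDAG) {q e : V} {l : List V}
    (hl0 : l ≠ []) (he : l.getLast? = some e) (hl : G.InducedUndir (q :: l)) :
    ¬ TransGen G.dir e q := by
  intro h
  induction h generalizing l with
  | single h =>
    match l, hl0 with
    | [b], _ =>
      simp only [List.getLast?_singleton, Option.some.injEq] at he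
      subst he
      exact G.dir_not_undir _ _ h (G.undir_symm _ _ hl.1)
    | b :: c :: r, _ =>
      exact hl.2.1 e (List.mem_of_getLast? (by simpa using he)) (Or.inr (Or.inl h))
  | tail hea haq ih =>
    obtain ⟨m, h0, h1, h2⟩ := hG.inducedUndir_move_start hl0 he hea hl haq
    exact ih h0 h1 h2

/-- The start of a possibly causal path is joined to an ancestor of its end by an induced
undirected path. -/
theorem IsMPDAG.exists_inducedUndir (hG : G.IsMPDAG) {w v : V} {l : List V}
    (hc : (w :: l).IsChain G.Adj) (hb : (w :: l).Pairwise fun a b => ¬ G.dir b a)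
    (hv : (w :: l).getLast? = some v) :
    ∃ m, m ⊆ l ∧ G.InducedUndir (w :: m) ∧
      ∃ e ∈ (w :: m).getLast?, ReflTransGen G.dir e v := by
  induction l generalizing w with
  | nil =>
    simp only [List.getLast?_singleton, Option.some.injEq] at hv
    subst hv
    exact ⟨[], by simp, trivial, w, by simp, .refl⟩
  | cons q r ih =>
    rw [List.isChain_cons_cons] at hc
    rw [List.pairwise_cons] at hb
    obtain ⟨m, hmr, hm, e, he, hev⟩ := ih hc.2 hb.2 (by simpa using hv)
    have hsub : q :: m ⊆ q :: r := List.cons_subset_cons _ hmr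
    rcases hG.inducedUndir_cons hm ⟨q, by simp, hc.1⟩ (fun c h => hb.1 c (hsub h)) with
      ⟨x, hx, hwx⟩ | ⟨n, h0, h1, h2⟩
    · obtain rfl : e = x := Option.mem_unique he hx
      exact ⟨[], by simp, trivial, w, by simp, .head hwx hev⟩
    · refine ⟨n, fun c hc => hsub (h1.subset hc), h2, e, ?_, hev⟩
      obtain ⟨y, n, rfl⟩ := List.exists_cons_of_ne_nil h0
      rw [List.getLast?_cons_cons, getLast?_eq_of_suffix h1 h0]
      exact he

/-- The start of a possibly causal path is not a descendant of its end. -/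
theorem IsMPDAG.not_transGen_of_possiblyCausal (hG : G.IsMPDAG) {w v : V} {l : List V}
    (hc : (w :: l).IsChain G.Adj) (hb : (w :: l).Pairwise fun a b => ¬ G.dir b a)
    (hv : (w :: l).getLast? = some v) : ¬ TransGen G.dir v w := by
  intro hvw
  obtain ⟨m, -, hm, e, he, hev⟩ := hG.exists_inducedUndir hc hb hv
  have hew : TransGen G.dir e w := TransGen.trans_right hev hvw
  cases m with
  | nil =>
    simp only [List.getLast?_singleton, Option.mem_def, Option.some.injEq] at he
    subst he
    exact hG.acyclic _ hew
  | cons b m => exact hG.not_transGen_of_inducedUndir (by simp) (by simpa using he) hm hew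

theorem IsMPDAG.not_transGen_of_possibleDesc (hG : G.IsMPDAG) {w v : V}
    (h : G.PossibleDesc w v) : ¬ TransGen G.dir v w := by
  rcases h with rfl | ⟨p, hp, hw, hv⟩
  · exact hG.acyclic _
  · rw [possiblyCausal_iff] at hp
    cases p with
    | nil => simp at hw
    | cons a l =>
      obtain rfl : a = w := by simpa using hw
      exact hG.not_transGen_of_possiblyCausal hp.2.2.1 hp.2.2.2 hv

theorem IsMPDAG.transGen_of_mem (hG : G.IsMPDAG) {x a : V} {l : List V}
    (hxa : ReflTransGen G.dir x a) (hc : (a :: l).IsChain G.Adj)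
    (hb : (a :: l).Pairwise fun a b => ¬ G.dir b a) (hx : ∀ u ∈ l, ¬ G.undir x u) :
    ∀ u ∈ l, TransGen G.dir x u := by
  induction l generalizing a with
  | nil => simp
  | cons b r ih =>
    rw [List.isChain_cons_cons] at hc
    rw [List.pairwise_cons] at hb
    have hxb : TransGen G.dir x b := by
      rcases hc.1 with h | h | h
      · exact TransGen.tail' hxa h
      · exact absurd h (hb.1 b (by simp))
      · exact (hG.undir_or_transGen hxa h).resolve_left (hx b (by simp))
    intro u hu
    rcases List.mem_cons.1 hu with rfl | hu
    · exact hxb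
    · exact ih hxb.to_reflTransGen hc.2 hb.2 (fun u hu => hx u (List.mem_cons_of_mem _ hu)) u hu

/-- If no possibly causal path from `x` to `y` starts with an undirected edge, then all nodes
of a possibly causal path from `x` to `y` are descendants of `x`. -/
theorem IsMPDAG.transGen_of_mem_possiblyCausal (hG : G.IsMPDAG) {x y w : V} {p : List V}
    (hno : ¬ ∃ p, G.PossiblyCausal p ∧ p.head? = some x ∧ p.getLast? = some y ∧
      G.StartsUndirected p)
    (hp : G.PossiblyCausal p) (hx : p.head? = some x) (hy : p.getLast? = some y)
    (hw : w ∈ p) (hwx : w ≠ x) : TransGen G.dir x w := by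
  cases p with
  | nil => simp at hw
  | cons a l =>
    obtain rfl : a = x := by simpa using hx
    obtain ⟨-, hn, hc, hb⟩ := possiblyCausal_iff.1 hp
    refine hG.transGen_of_mem .refl hc hb ?_ w ((List.mem_cons.1 hw).resolve_left hwx)
    intro u hu hau
    obtain ⟨s, t, rfl⟩ := List.append_of_mem hu
    have hsub : (a :: u :: t).Sublist (a :: (s ++ u :: t)) :=
      (List.sublist_append_right _ _).cons_cons _
    have hsuf : (u :: t) <:+ (a :: (s ++ u :: t)) :=
      (List.suffix_append s (u :: t)).trans (List.suffix_cons _ _)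
    refine hno ⟨a :: u :: t, possiblyCausal_iff.2 ⟨by simp, hn.sublist hsub, ?_, hb.sublist hsub⟩,
      rfl, ?_, a, u, t, rfl, hau⟩
    · exact List.isChain_cons_cons.2 ⟨Or.inr (Or.inr hau), hc.suffix hsuf⟩
    · rw [List.getLast?_cons_cons, getLast?_eq_of_suffix hsuf (by simp), hy]

/-- A walk consisting of undirected edges followed by directed edges. -/
inductive UndirThenDir (G : PDG V) : List V → Prop
  | dir {l : List V} : l.IsChain G.dir → UndirThenDir G l
  | undir {a b : V} {l : List V} :
      G.undir a b → UndirThenDir G (b :: l) → UndirThenDir G (a :: b :: l)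

theorem UndirThenDir.suffix {l m : List V} (h : G.UndirThenDir l) (hm : m <:+ l) :
    G.UndirThenDir m := by
  induction h with
  | dir h => exact .dir (h.suffix hm)
  | undir hab h ih =>
    rcases List.suffix_cons_iff.1 hm with rfl | hm
    · exact .undir hab h
    · exact ih hm

theorem Acyclic.pairwise_of_isChain (hG : G.Acyclic) {l : List V} (h : l.IsChain G.dir) :
    l.Pairwise fun a b => ¬ G.dir b a := by
  have h' : l.IsChain (TransGen G.dir) := h.imp fun _ _ => TransGen.single
  exact h'.pairwise.imp fun hab hba => hG _ (TransGen.tail hab hba)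

/-- Undirected edges followed by directed edges can be shortened to a possibly causal path,
if no node points to the start. -/
theorem IsMPDAG.exists_sublist_of_undirThenDir (hG : G.IsMPDAG) {x y : V} {l : List V}
    (hl : G.UndirThenDir (y :: l)) (hxy : G.undir x y) (hx : ∀ t ∈ y :: l, ¬ G.dir t x) :
    ∃ z m, (z :: m).Sublist (y :: l) ∧ G.undir x z ∧
      (z :: m).getLast? = (y :: l).getLast? ∧ (x :: z :: m).IsChain G.Adj ∧
      (x :: z :: m).Pairwise fun a b => ¬ G.dir b a := by
  induction hn : l.length using Nat.strong_induction_on generalizing x y l with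
  | _ n ih =>
    subst hn
    by_cases hback : ∃ t ∈ l, G.dir t y
    · obtain ⟨t, ht, hty⟩ := hback
      have hxt : G.undir x t := by
        refine G.undir_symm _ _ ?_
        exact (hG.dir_or_undir_of_dir_undir hty (G.undir_symm _ _ hxy)).resolve_left
          (hx t (List.mem_cons_of_mem _ ht))
      obtain ⟨s, r, rfl⟩ := List.append_of_mem ht
      have hsuf : (t :: r) <:+ (y :: (s ++ t :: r)) :=
        (List.suffix_append s (t :: r)).trans (List.suffix_cons _ _)
      obtain ⟨z, m, h1, h2, h3, h4⟩ := ih r.length (by simp; omega) (hl.suffix hsuf) hxt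
        (fun c hc => hx c (hsuf.subset hc)) rfl
      exact ⟨z, m, h1.trans hsuf.sublist, h2,
        h3.trans (getLast?_eq_of_suffix hsuf (by simp)), h4⟩
    · push Not at hback
      cases hl with
      | dir h =>
        refine ⟨y, l, List.Sublist.refl _, hxy, rfl, ?_, ?_⟩
        · exact List.isChain_cons_cons.2 ⟨Or.inr (Or.inr hxy), h.imp fun _ _ => Or.inl⟩
        · exact List.pairwise_cons.2 ⟨hx, hG.acyclic.pairwise_of_isChain h⟩
      | @undir _ b r hyb h =>
        obtain ⟨z, m, h1, h2, h3, h4, h5⟩ := ih r.length (by simp) h hyb hback rfl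
        have hsub : (y :: z :: m).Sublist (y :: b :: r) := h1.cons_cons _
        refine ⟨y, z :: m, hsub, hxy, by simpa using h3, ?_, ?_⟩
        · exact List.isChain_cons_cons.2 ⟨Or.inr (Or.inr hxy), h4⟩
        · exact List.pairwise_cons.2 ⟨fun c hc => hx c (hsub.subset hc), h5⟩

/-- A walk of undirected edges followed by directed edges whose later nodes do not point to
its start `x` does not reach a node with a descendant among the parents of `x` by one more
directed edge. -/
theorem IsMPDAG.not_dir_of_undirThenDir (hG : G.IsMPDAG) {x y e c z : V} {l : List V}
    (hl : G.UndirThenDir (y :: l)) (hxy : G.undir x y) (hx : ∀ t ∈ y :: l, ¬ G.dir t x)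
    (he : (y :: l).getLast? = some e) (hcz : ReflTransGen G.dir c z) (hzx : G.dir z x) :
    ¬ G.dir e c := by
  intro hec
  obtain ⟨_, _, -, -, h3, h4, h5⟩ := hG.exists_sublist_of_undirThenDir hl hxy hx
  exact hG.not_transGen_of_possiblyCausal h4 h5 (by rw [List.getLast?_cons_cons, h3, he])
    ((TransGen.head' hec hcz).tail hzx)

/-- Recursive form of being of definite status and d-connecting given `Z`. -/
def DConnStatus (G : PDG V) (Z : Finset V) : List V → Prop
  | [] => True
  | [_] => True
  | [_, _] => True
  | a :: b :: c :: l =>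
    ((G.dir a b ∧ G.dir c b ∧ ∃ z ∈ Z, ReflTransGen G.dir b z) ∨
      ((G.dir b a ∨ G.dir b c ∨ (G.undir a b ∧ G.undir b c)) ∧ b ∉ Z)) ∧
    G.DConnStatus Z (b :: c :: l)

theorem ColliderAt.cons {l : List V} {i : ℕ} (a : V) (h : G.ColliderAt l i) :
    G.ColliderAt (a :: l) (i + 1) := by
  obtain ⟨u, v, w, h1, h2, h3, h4, h5⟩ := h
  obtain ⟨i, rfl⟩ := Nat.exists_eq_add_of_le' h4
  exact ⟨u, v, w, by simpa using h1, by simpa using h2, by simpa using h3, by simp, h5⟩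

theorem DefNonColliderAt.cons {l : List V} {i : ℕ} (a : V) (h : G.DefNonColliderAt l i) :
    G.DefNonColliderAt (a :: l) (i + 1) := by
  obtain ⟨u, v, w, h1, h2, h3, h4, h5⟩ := h
  obtain ⟨i, rfl⟩ := Nat.exists_eq_add_of_le' h4
  exact ⟨u, v, w, by simpa using h1, by simpa using h2, by simpa using h3, by simp, h5⟩

theorem ColliderAt.of_cons {a : V} {l : List V} {i : ℕ} (hi : 1 ≤ i)
    (h : G.ColliderAt (a :: l) (i + 1)) : G.ColliderAt l i := by
  obtain ⟨u, v, w, h1, h2, h3, h4, h5⟩ := h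
  obtain ⟨i, rfl⟩ := Nat.exists_eq_add_of_le' hi
  exact ⟨u, v, w, by simpa using h1, by simpa using h2, by simpa using h3, by simp, h5⟩

theorem DefNonColliderAt.of_cons {a : V} {l : List V} {i : ℕ} (hi : 1 ≤ i)
    (h : G.DefNonColliderAt (a :: l) (i + 1)) : G.DefNonColliderAt l i := by
  obtain ⟨u, v, w, h1, h2, h3, h4, h5⟩ := h
  obtain ⟨i, rfl⟩ := Nat.exists_eq_add_of_le' hi
  exact ⟨u, v, w, by simpa using h1, by simpa using h2, by simpa using h3, by simp, h5⟩

theorem DConnDS.dConnStatus {Z : Finset V} {p : List V} (hs : G.DefiniteStatus p)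
    (h : G.DConnDS Z p) : G.DConnStatus Z p := by
  induction p with
  | nil => trivial
  | cons a l ih =>
    match l with
    | [] => trivial
    | [b] => trivial
    | b :: c :: l =>
      refine ⟨?_, ih ?_ ?_⟩
      · rcases hs 1 le_rfl (by simp) with h' | h'
        · have hZ := h.2 1 b h' rfl
          obtain ⟨u, v, w, h1, h2, h3, -, h4, h5⟩ := h'
          simp only [Nat.sub_self, List.getElem?_cons_zero, List.getElem?_cons_succ,
            Option.some.injEq] at h1 h2 h3
          subst h1 h2 h3
          exact Or.inl ⟨h4, h5, hZ⟩
        · have hZ := h.1 1 b h' rfl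
          obtain ⟨u, v, w, h1, h2, h3, -, h4⟩ := h'
          simp only [Nat.sub_self, List.getElem?_cons_zero, List.getElem?_cons_succ,
            Option.some.injEq] at h1 h2 h3
          subst h1 h2 h3
          exact Or.inr ⟨h4.imp_right (Or.imp_right fun h => ⟨h.1, h.2.1⟩), hZ⟩
      · intro i hi hil
        exact (hs (i + 1) (by omega) (by simpa using hil)).imp
          (ColliderAt.of_cons hi) (DefNonColliderAt.of_cons hi)
      · exact ⟨fun i u hi hu => h.1 (i + 1) u (hi.cons a) (by simpa using hu),
          fun i u hi hu => h.2 (i + 1) u (hi.cons a) (by simpa using hu)⟩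

/-- A d-connecting path that starts with a directed edge out of its first node is causal or
reaches a collider by a causal subpath. -/
theorem DConnStatus.of_dir {Z : Finset V} {a b : V} {r : List V}
    (h : G.DConnStatus Z (a :: b :: r)) (hab : G.dir a b)
    (hZ : ∀ y ∈ (b :: r).getLast?, y ∉ Z) :
    ((a :: b :: r).IsChain G.dir ∧ ∀ t ∈ b :: r, t ∉ Z) ∨
      ∃ l e c, (a :: l).IsChain G.dir ∧ (∀ t ∈ l, t ∉ Z) ∧ e ∈ (a :: l).getLast? ∧
        ReflTransGen G.dir a e ∧ G.dir e c ∧ ∃ z ∈ Z, ReflTransGen G.dir c z := by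
  induction r generalizing a b with
  | nil =>
    left
    simpa [hab] using hZ
  | cons c r ih =>
    rcases h.1 with ⟨-, -, hbZ⟩ | ⟨hnc, hbZ⟩
    · exact Or.inr ⟨[], a, b, by simp, by simp, by simp, .refl, hab, hbZ⟩
    · have hbc : G.dir b c := by
        rcases hnc with h | h | h
        · exact absurd h (G.dir_asymm _ _ hab)
        · exact h
        · exact absurd h.1 (G.dir_not_undir _ _ hab)
      rcases ih h.2 hbc (by simpa using hZ) with ⟨h1, h2⟩ | ⟨l, e, d, h1, h2, h3, h4, h5⟩
      · exact Or.inl ⟨List.isChain_cons_cons.2 ⟨hab, h1⟩, List.forall_mem_cons.2 ⟨hbZ, h2⟩⟩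
      · exact Or.inr ⟨b :: l, e, d, List.isChain_cons_cons.2 ⟨hab, h1⟩,
          List.forall_mem_cons.2 ⟨hbZ, h2⟩, by simpa using h3, .head hab h4, h5⟩

/-- A d-connecting path that starts with an undirected edge consists of undirected edges
followed by directed edges, or it has a subpath of this kind that reaches a collider. -/
theorem DConnStatus.of_undir {Z : Finset V} {a b : V} {r : List V}
    (h : G.DConnStatus Z (a :: b :: r)) (hab : G.undir a b)
    (hZ : ∀ y ∈ (b :: r).getLast?, y ∉ Z) :
    (G.UndirThenDir (b :: r) ∧ ∀ t ∈ b :: r, t ∉ Z) ∨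
      ∃ l e c, G.UndirThenDir (b :: l) ∧ (∀ t ∈ b :: l, t ∉ Z) ∧ e ∈ (b :: l).getLast? ∧
        G.dir e c ∧ ∃ z ∈ Z, ReflTransGen G.dir c z := by
  induction r generalizing a b with
  | nil => exact Or.inl ⟨.dir (.singleton b), by simpa using hZ⟩
  | cons c r ih =>
    have hZ' : ∀ y ∈ (c :: r).getLast?, y ∉ Z := by simpa using hZ
    rcases h.1 with ⟨h', -⟩ | ⟨hnc, hbZ⟩
    · exact absurd hab (G.dir_not_undir _ _ h')
    · rcases hnc with h' | hbc | ⟨-, hbc⟩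
      · exact absurd (G.undir_symm _ _ hab) (G.dir_not_undir _ _ h')
      · rcases h.2.of_dir hbc hZ' with ⟨h1, h2⟩ | ⟨l, e, d, h1, h2, h3, -, h5⟩
        · exact Or.inl ⟨.dir h1, List.forall_mem_cons.2 ⟨hbZ, h2⟩⟩
        · exact Or.inr ⟨l, e, d, .dir h1, List.forall_mem_cons.2 ⟨hbZ, h2⟩, h3, h5⟩
      · rcases ih h.2 hbc hZ' with ⟨h1, h2⟩ | ⟨l, e, d, h1, h2, h3, h5⟩
        · exact Or.inl ⟨.undir hbc h1, List.forall_mem_cons.2 ⟨hbZ, h2⟩⟩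
        · exact Or.inr ⟨c :: l, e, d, .undir hbc h1, List.forall_mem_cons.2 ⟨hbZ, h2⟩,
            by simpa using h3, h5⟩

theorem mem_paFin [Fintype V] {u v : V} : u ∈ G.paFin v ↔ G.dir u v := by
  simp [paFin]

end PDG

/-- if `Y ∉ Pa(X,G)` and no possibly causal path from `X` to `Y`
starts with an undirected edge, then `Pa(X,G)` satisfies the generalized adjustment
criterion relative to `(X, Y)` in `G`. -/
theorem stmt15 {V : Type} [Fintype V] [DecidableEq V]
    (G : PDG V) (hG : G.IsMPDAG) (X Y : V) (hXY : X ≠ Y)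
    (hYnotpa : Y ∉ G.paFin X)
    (hno : ¬ ∃ p, G.PossiblyCausal p ∧ p.head? = some X ∧ p.getLast? = some Y ∧
      G.StartsUndirected p) :
    (¬ ∃ p, G.PossiblyCausal p ∧ ProperFrom {X} p ∧ EndsIn {Y} p ∧
        G.StartsUndirected p) ∧
    (∀ v ∈ G.paFin X, v ∉ G.Forb X Y) ∧
    (∀ p, G.IsPathFrom p X Y → ProperFrom {X} p → G.DefiniteStatus p →
      ¬ G.PossiblyCausal p → G.Blocks (G.paFin X) p) := by
  refine ⟨?_, ?_, ?_⟩
  · rintro ⟨p, hp, ⟨⟨a, ha, hpa⟩, -⟩, ⟨b, hb, hpb⟩, hs⟩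
    rw [Finset.mem_singleton] at ha hb
    subst ha hb
    exact hno ⟨p, hp, hpa, hpb, hs⟩
  · intro v hv hforb
    obtain ⟨w, hwX, ⟨p, hp, hpX, hpY, hwp⟩, hwv⟩ := (Finset.mem_filter.1 hforb).2
    exact hG.not_transGen_of_possibleDesc hwv
      ((hG.transGen_of_mem_possiblyCausal hno hp hpX hpY hwp hwX).head (mem_paFin.1 hv))
  · rintro p ⟨⟨hlen, hnd, hadj⟩, hpX, hpY⟩ - hds hnc hconn
    have hstat := hconn.dConnStatus hds
    match p, hlen with
    | a :: b :: r, _ =>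
    obtain rfl : a = X := by simpa using hpX
    rw [List.getLast?_cons_cons] at hpY
    have hlast : ∀ y ∈ (b :: r).getLast?, y ∉ G.paFin a := by
      intro y hy
      rw [hpY, Option.mem_some_iff] at hy
      exact hy ▸ hYnotpa
    rcases (List.isChain_cons_cons.1 hadj).1 with h | h | h
    · rcases hstat.of_dir h hlast with ⟨h1, -⟩ | ⟨l, e, c, -, -, -, hae, hec, z, hz, hcz⟩
      · exact hnc (possiblyCausal_iff.2 ⟨by simp, hnd, hadj, hG.acyclic.pairwise_of_isChain h1⟩)
      · exact hG.acyclic a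
          ((Relation.TransGen.tail' hae hec).trans_left hcz |>.tail (mem_paFin.1 hz))
    · cases r with
      | nil => exact hlast b (by simp) (mem_paFin.2 h)
      | cons c r =>
        rcases hstat.1 with ⟨h', -⟩ | ⟨-, h'⟩
        · exact G.dir_asymm _ _ h h'
        · exact h' (mem_paFin.2 h)
    · rcases hstat.of_undir h hlast with ⟨h1, h2⟩ | ⟨l, e, c, h1, h2, h3, hec, z, hz, hcz⟩
      · obtain ⟨z, m, hsub, haz, hm, hc, hb⟩ := hG.exists_sublist_of_undirThenDir h1 h
          fun t ht hta => h2 t ht (mem_paFin.2 hta)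
        exact hno ⟨a :: z :: m, possiblyCausal_iff.2
          ⟨by simp, hnd.sublist (hsub.cons_cons a), hc, hb⟩, rfl,
          by rw [List.getLast?_cons_cons, hm, hpY], a, z, m, rfl, haz⟩
      · exact hG.not_dir_of_undirThenDir h1 h (fun t ht hta => h2 t ht (mem_paFin.2 hta)) h3
          hcz (mem_paFin.1 hz) hec
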